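/- arXiv:2602.00937 — 5 statements merged into one kernel-verified Lean document; each statement's English description precedes it below -/
import Mathlib

section
/- Let l ≥ 1, let δ_m : ℝ³ →ₗ[ℝ] ℝ (m : Fin l) be linear maps, let P be an orthogonal (2l)×(2l) real matrix (an element of the orthogonal group of matrices indexed by Fin l × Fin 2), let q, k ∈ ℝ^{2l}, and let r_i, r_j ∈ ℝ³. Set v = Pᵀ ·ᵥ q and w = Pᵀ ·ᵥ k, and for each m : Fin l let v_m, w_m ∈ ℝ² denote the m-th coordinate blocks of v and w. Then the Cayley-STRING logit score s = ⟪P · RoPE(r_i) · Pᵀ ·ᵥ q , P · RoPE(r_j) · Pᵀ ·ᵥ k⟫ satisfies s = Σ_{m : Fin l} ‖v_m‖ · ‖w_m‖ · Real.Angle.cos( oangle v_m w_m + ↑(δ_m (r_j − r_i)) ). -/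
open Real Matrix

open scoped RealInnerProductSpace

noncomputable section

instance : Fact (Module.finrank ℝ (EuclideanSpace ℝ (Fin 2)) = 2) :=
  ⟨finrank_euclideanSpace_fin⟩

/-- The standard orientation of the Euclidean plane `EuclideanSpace ℝ (Fin 2)`. -/
def stdOrient : Orientation ℝ (EuclideanSpace ℝ (Fin 2)) (Fin 2) :=
  (EuclideanSpace.basisFun (Fin 2) ℝ).toBasis.orientation

/-- Oriented angle from `u` to `v` w.r.t. the standard orientation
(`0` if `u = 0` or `v = 0`). -/
def oangle (u v : EuclideanSpace ℝ (Fin 2)) : Real.Angle := stdOrient.oangle u v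

/-- Counterclockwise rotation of the plane by angle `θ`, i.e. the linear isometry with
matrix `[[cos θ, −sin θ], [sin θ, cos θ]]` in the standard basis. -/
def rot (θ : ℝ) (u : EuclideanSpace ℝ (Fin 2)) : EuclideanSpace ℝ (Fin 2) :=
  (WithLp.equiv 2 (Fin 2 → ℝ)).symm
    ![Real.cos θ * u 0 - Real.sin θ * u 1, Real.sin θ * u 0 + Real.cos θ * u 1]

/-- The `m`-th coordinate block (in `ℝ²`) of a vector in `ℝ^{2l}`. -/
def blk {l : ℕ} (q : EuclideanSpace ℝ (Fin l × Fin 2)) (m : Fin l) :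
    EuclideanSpace ℝ (Fin 2) :=
  (WithLp.equiv 2 (Fin 2 → ℝ)).symm fun i => q (m, i)

/-- The `m`-th coordinate block (in `ℝ²`) of a plain vector `Fin l × Fin 2 → ℝ`. -/
def blkF {l : ℕ} (q : Fin l × Fin 2 → ℝ) (m : Fin l) : EuclideanSpace ℝ (Fin 2) :=
  (WithLp.equiv 2 (Fin 2 → ℝ)).symm fun i => q (m, i)

/-- The 2×2 rotation matrix by angle `θ`. -/
def rotMat (θ : ℝ) : Matrix (Fin 2) (Fin 2) ℝ :=
  !![Real.cos θ, -Real.sin θ; Real.sin θ, Real.cos θ]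

/-- The `(2l)×(2l)` block-diagonal RoPE matrix whose `m`-th `2×2` diagonal block is the
rotation matrix by angle `δ m v`. -/
def RoPE {l : ℕ} (δ : Fin l → (EuclideanSpace ℝ (Fin 3) →ₗ[ℝ] ℝ))
    (v : EuclideanSpace ℝ (Fin 3)) : Matrix (Fin l × Fin 2) (Fin l × Fin 2) ℝ :=
  fun p q => if p.1 = q.1 then rotMat (δ p.1 v) p.2 q.2 else 0

/-- `K(R,r)`: vectors of norm at most `R` all of whose coordinates have absolute
value at least `r`. -/
def K (l : ℕ) (R r : ℝ) : Set (EuclideanSpace ℝ (Fin l × Fin 2)) :=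
  {q | ‖q‖ ≤ R ∧ ∀ i, r ≤ |q i|}


theorem stdOrient_areaForm (u v : EuclideanSpace ℝ (Fin 2)) :
    stdOrient.areaForm u v = u 0 * v 1 - u 1 * v 0 := by
  rw [Orientation.areaForm_to_volumeForm,
    stdOrient.volumeForm_robust (EuclideanSpace.basisFun (Fin 2) ℝ) rfl,
    Module.Basis.det_apply, Matrix.det_fin_two]
  simp [Module.Basis.toMatrix_apply]
  ring

theorem norm_mul_norm_mul_sin_oangle (u v : EuclideanSpace ℝ (Fin 2)) :
    ‖u‖ * ‖v‖ * (oangle u v).sin = stdOrient.areaForm u v := by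
  rw [oangle, Orientation.oangle, Real.Angle.sin_coe, ← stdOrient.norm_kahler,
    Complex.norm_mul_sin_arg, Orientation.kahler_apply_apply]
  simp

theorem norm_mul_norm_mul_cos_oangle_add (u v : EuclideanSpace ℝ (Fin 2)) (θ : ℝ) :
    ‖u‖ * ‖v‖ * (oangle u v + (θ : Real.Angle)).cos =
      (u 0 * v 0 + u 1 * v 1) * Real.cos θ - (u 0 * v 1 - u 1 * v 0) * Real.sin θ := by
  have hcos : ‖u‖ * ‖v‖ * (oangle u v).cos = u 0 * v 0 + u 1 * v 1 := by
    rw [oangle, ← Orientation.inner_eq_norm_mul_norm_mul_cos_oangle]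
    simp [PiLp.inner_apply, Fin.sum_univ_two, mul_comm]
  have hsin := norm_mul_norm_mul_sin_oangle u v
  rw [stdOrient_areaForm] at hsin
  rw [Real.Angle.cos_add, Real.Angle.cos_coe, Real.Angle.sin_coe, ← hcos, ← hsin]
  ring

theorem RoPE_mulVec {l : ℕ} (δ : Fin l → (EuclideanSpace ℝ (Fin 3) →ₗ[ℝ] ℝ))
    (r : EuclideanSpace ℝ (Fin 3)) (v : Fin l × Fin 2 → ℝ) (m : Fin l) (i : Fin 2) :
    (RoPE δ r *ᵥ v) (m, i) = (rotMat (δ m r) *ᵥ fun j => v (m, j)) i := by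
  simp [Matrix.mulVec, dotProduct, RoPE, Fintype.sum_prod_type]

theorem orthogonal_mulVec_dotProduct_mulVec {n : Type*} [Fintype n] [DecidableEq n]
    (P : Matrix.orthogonalGroup n ℝ) (a b : n → ℝ) :
    ((P : Matrix n n ℝ) *ᵥ a) ⬝ᵥ ((P : Matrix n n ℝ) *ᵥ b) = a ⬝ᵥ b := by
  have h : (P : Matrix n n ℝ)ᵀ * (P : Matrix n n ℝ) = 1 :=
    (Matrix.mem_orthogonalGroup_iff' n ℝ).mp P.2
  rw [Matrix.dotProduct_mulVec, ← Matrix.mulVec_transpose, Matrix.mulVec_mulVec, h,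
    Matrix.one_mulVec]

/-- Lemma 1, Cayley-STRING logit score formula: the Cayley-STRING logit
score `⟪P · RoPE(rᵢ) · Pᵀ ·ᵥ q, P · RoPE(rⱼ) · Pᵀ ·ᵥ k⟫` equals
`Σ_m ‖v_m‖ ‖w_m‖ cos(oangle v_m w_m + δ_m (rⱼ − rᵢ))` where `v = Pᵀ ·ᵥ q`, `w = Pᵀ ·ᵥ k`. -/
theorem stmt0 {l : ℕ} (hl : 1 ≤ l)
    (δ : Fin l → (EuclideanSpace ℝ (Fin 3) →ₗ[ℝ] ℝ))
    (P : Matrix.orthogonalGroup (Fin l × Fin 2) ℝ)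
    (q k : Fin l × Fin 2 → ℝ) (ri rj : EuclideanSpace ℝ (Fin 3)) :
    (((P : Matrix (Fin l × Fin 2) (Fin l × Fin 2) ℝ) * RoPE δ ri *
        (P : Matrix (Fin l × Fin 2) (Fin l × Fin 2) ℝ)ᵀ) *ᵥ q) ⬝ᵥ
      (((P : Matrix (Fin l × Fin 2) (Fin l × Fin 2) ℝ) * RoPE δ rj *
        (P : Matrix (Fin l × Fin 2) (Fin l × Fin 2) ℝ)ᵀ) *ᵥ k) =
    ∑ m : Fin l,
      ‖blkF ((P : Matrix (Fin l × Fin 2) (Fin l × Fin 2) ℝ)ᵀ *ᵥ q) m‖ *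
        ‖blkF ((P : Matrix (Fin l × Fin 2) (Fin l × Fin 2) ℝ)ᵀ *ᵥ k) m‖ *
        Real.Angle.cos
          (oangle (blkF ((P : Matrix (Fin l × Fin 2) (Fin l × Fin 2) ℝ)ᵀ *ᵥ q) m)
              (blkF ((P : Matrix (Fin l × Fin 2) (Fin l × Fin 2) ℝ)ᵀ *ᵥ k) m) +
            (↑(δ m (rj - ri)) : Real.Angle)) := by
  simp only [← Matrix.mulVec_mulVec]
  rw [orthogonal_mulVec_dotProduct_mulVec]
  generalize (P : Matrix (Fin l × Fin 2) (Fin l × Fin 2) ℝ)ᵀ *ᵥ q = v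
  generalize (P : Matrix (Fin l × Fin 2) (Fin l × Fin 2) ℝ)ᵀ *ᵥ k = w
  rw [dotProduct, Fintype.sum_prod_type]
  refine Finset.sum_congr rfl fun m _ => ?_
  rw [norm_mul_norm_mul_cos_oangle_add, map_sub, Real.cos_sub, Real.sin_sub]
  simp only [RoPE_mulVec]
  simp only [rotMat, blkF, Matrix.mulVec, dotProduct, Fin.sum_univ_two,
    Matrix.of_apply, Matrix.cons_val_zero, Matrix.cons_val_one, WithLp.equiv_symm_apply]
  ring

end
end

section
/- Let l ≥ 1, T > 0, φ ∈ (0, π/3], and R ≥ r > 0. Then there exists ε > 0 with the following property: for all q, k ∈ ℝ^{2l} with q, k ∈ K(R,r) and ⟪q, k⟫ ≥ (1 − ε) · ‖q‖ · ‖k‖, the logit-score function s : ℝ → ℝ defined by s(η) = Σ_{m : Fin l} ⟪ q_m , rot(η / T) (k_m) ⟫ (which is the Cayley-STRING score obtained from the linear function δ(r) = ⟪r, r_{i,j}⟫ / (T · ‖r_{i,j}‖²) when the second sub-point cloud is translated so that the vector joining the centers of mass is η · r_{i,j}) is strictly decreasing on the interval [2Tφ, T(π − φ)] and strictly increasing on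 the interval [−T(π − φ), −2Tφ]; in particular, separately for positive η and for negative η, s(η) is a strictly decreasing function of |η| for |η| ∈ [2Tφ, T(π − φ)]. -/
open Real Matrix

open scoped RealInnerProductSpace

noncomputable section

/-- The vector obtained by rotating each coordinate block of `k` by a right angle. -/
def blockPerp {l : ℕ} (k : EuclideanSpace ℝ (Fin l × Fin 2)) :
    EuclideanSpace ℝ (Fin l × Fin 2) :=
  WithLp.toLp 2 fun p => ![-k (p.1, 1), k (p.1, 0)] p.2

lemma inner_blockPerp_self {l : ℕ} (k : EuclideanSpace ℝ (Fin l × Fin 2)) :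
    ⟪k, blockPerp k⟫ = 0 := by
  simp only [PiLp.inner_apply, Fintype.sum_prod_type, Fin.sum_univ_two, blockPerp]
  refine Finset.sum_eq_zero fun m _ => ?_
  simp
  ring

lemma norm_blockPerp {l : ℕ} (k : EuclideanSpace ℝ (Fin l × Fin 2)) :
    ‖blockPerp k‖ = ‖k‖ := by
  simp only [EuclideanSpace.norm_eq, Fintype.sum_prod_type, Fin.sum_univ_two, blockPerp]
  congr 1
  refine Finset.sum_congr rfl fun m _ => ?_
  simp
  ring

/-- Rotating every block by the same angle turns the score into a trigonometric polynomial
of degree one. -/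
lemma sum_inner_rot {l : ℕ} (q k : EuclideanSpace ℝ (Fin l × Fin 2)) (θ : ℝ) :
    ∑ m : Fin l, ⟪blk q m, rot θ (blk k m)⟫ =
      ⟪q, k⟫ * Real.cos θ + ⟪q, blockPerp k⟫ * Real.sin θ := by
  simp only [PiLp.inner_apply, Fintype.sum_prod_type, Fin.sum_univ_two, blockPerp, blk, rot,
    Finset.sum_mul, ← Finset.sum_add_distrib]
  refine Finset.sum_congr rfl fun m _ => ?_
  simp
  ring

/-- Bessel's inequality for two orthogonal vectors of equal norm. -/
lemma sq_inner_add_sq_inner_le {E : Type*} [NormedAddCommGroup E] [InnerProductSpace ℝ E]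
    {q k j : E} (hkj : ⟪k, j⟫ = 0) (hj : ‖j‖ = ‖k‖) :
    ⟪q, k⟫ ^ 2 + ⟪q, j⟫ ^ 2 ≤ (‖q‖ * ‖k‖) ^ 2 := by
  set a := ⟪q, k⟫ with ha
  set b := ⟪q, j⟫ with hb
  have h1 : ⟪q, a • k + b • j⟫ = a ^ 2 + b ^ 2 := by
    rw [inner_add_right, inner_smul_right, inner_smul_right, ← ha, ← hb]
    ring
  have h2 : ‖a • k + b • j‖ ^ 2 = (a ^ 2 + b ^ 2) * ‖k‖ ^ 2 := by
    rw [norm_add_sq_real, inner_smul_left, inner_smul_right, hkj, norm_smul, norm_smul, hj,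
      mul_pow, mul_pow, Real.norm_eq_abs, Real.norm_eq_abs, sq_abs, sq_abs]
    ring
  have h3 : (a ^ 2 + b ^ 2) ^ 2 ≤ (a ^ 2 + b ^ 2) * (‖q‖ * ‖k‖) ^ 2 := by
    calc (a ^ 2 + b ^ 2) ^ 2 = ⟪q, a • k + b • j⟫ ^ 2 := by rw [h1]
      _ ≤ (‖q‖ * ‖a • k + b • j‖) ^ 2 :=
        sq_le_sq' (neg_le_of_abs_le (abs_real_inner_le_norm _ _)) (real_inner_le_norm _ _)
      _ = (a ^ 2 + b ^ 2) * (‖q‖ * ‖k‖) ^ 2 := by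
        rw [mul_pow, h2]
        ring
  rcases (by positivity : 0 ≤ a ^ 2 + b ^ 2).eq_or_lt with h | h
  · rw [← h]
    positivity
  · rw [sq (a ^ 2 + b ^ 2)] at h3
    exact le_of_mul_le_mul_left h3 h

/-- If `(a, b)` has norm at most `N` and `a` is close to `N`, then `b` is small relative
to `a`. -/
lemma abs_lt_mul_of_near_norm {a b N s : ℝ} (hs : 0 < s) (hs1 : s ≤ 1) (hN : 0 < N)
    (hab : a ^ 2 + b ^ 2 ≤ N ^ 2) (ha : (1 - s ^ 2 / 4) * N ≤ a) : |b| < a * s := by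
  have hs2 : s ^ 2 ≤ 1 := pow_le_one₀ hs.le hs1
  have hs0 : 0 < s ^ 2 := by positivity
  have hc : 0 < (1 - s ^ 2 / 4) * N := mul_pos (by linarith) hN
  have ha0 : 0 < a := hc.trans_le ha
  have h1 : ((1 - s ^ 2 / 4) * N) ^ 2 ≤ a ^ 2 := pow_le_pow_left₀ hc.le ha 2
  have h2 : 1 < (1 - s ^ 2 / 4) ^ 2 * (1 + s ^ 2) := by
    nlinarith [mul_nonneg hs0.le (sub_nonneg.2 hs2), pow_pos hs0 2, pow_pos hs0 3]
  have h3 : N ^ 2 < a ^ 2 * (1 + s ^ 2) :=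
    calc N ^ 2 < N ^ 2 * ((1 - s ^ 2 / 4) ^ 2 * (1 + s ^ 2)) :=
          lt_mul_of_one_lt_right (by positivity) h2
      _ = ((1 - s ^ 2 / 4) * N) ^ 2 * (1 + s ^ 2) := by ring
      _ ≤ a ^ 2 * (1 + s ^ 2) := by gcongr
  exact abs_lt_of_sq_lt_sq (by nlinarith) (by positivity)

lemma trig_sub_trig (a b x y : ℝ) :
    (a * Real.cos x + b * Real.sin x) - (a * Real.cos y + b * Real.sin y) =
      2 * Real.sin ((y - x) / 2) *
        (a * Real.sin ((x + y) / 2) - b * Real.cos ((x + y) / 2)) := by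
  have hx : x = (x + y) / 2 - (y - x) / 2 := by ring
  have hy : y = (x + y) / 2 + (y - x) / 2 := by ring
  generalize (x + y) / 2 = u at *
  generalize (y - x) / 2 = v at *
  rw [hx, hy, Real.cos_sub, Real.sin_sub, Real.cos_add, Real.sin_add]
  ring

lemma sin_le_sin_of_mem_Icc {φ x : ℝ} (hφ : 0 ≤ φ) (hx : x ∈ Set.Icc φ (π - φ)) :
    Real.sin φ ≤ Real.sin x := by
  obtain ⟨h1, h2⟩ := hx
  rcases le_total x (π / 2) with h | h
  · exact Real.sin_le_sin_of_le_of_le_pi_div_two (by linarith [Real.pi_pos]) h h1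
  · rw [← Real.sin_pi_sub x]
    exact Real.sin_le_sin_of_le_of_le_pi_div_two (by linarith [Real.pi_pos]) (by linarith)
      (by linarith)

lemma mul_cos_lt_mul_sin {a b φ x : ℝ} (hφ : 0 ≤ φ) (ha : 0 ≤ a)
    (hb : |b| < a * Real.sin φ) (hx : x ∈ Set.Icc φ (π - φ)) :
    |b * Real.cos x| < a * Real.sin x :=
  calc |b * Real.cos x| = |b| * |Real.cos x| := abs_mul _ _
    _ ≤ |b| := mul_le_of_le_one_right (abs_nonneg b) (Real.abs_cos_le_one x)
    _ < a * Real.sin φ := hb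
    _ ≤ a * Real.sin x := mul_le_mul_of_nonneg_left (sin_le_sin_of_mem_Icc hφ hx) ha

lemma strictAntiOn_trig {a b φ : ℝ} (hφ : 0 < φ) (ha : 0 ≤ a)
    (hb : |b| < a * Real.sin φ) :
    StrictAntiOn (fun x : ℝ => a * Real.cos x + b * Real.sin x) (Set.Icc φ (π - φ)) := by
  rintro x ⟨hx1, hx2⟩ y ⟨hy1, hy2⟩ hxy
  refine sub_pos.1 ?_
  simp only [trig_sub_trig]
  have hsin : 0 < Real.sin ((y - x) / 2) :=
    Real.sin_pos_of_pos_of_lt_pi (by linarith) (by linarith)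
  have hmid := mul_cos_lt_mul_sin (x := (x + y) / 2) hφ.le ha hb
    ⟨by linarith, by linarith⟩
  exact mul_pos (by positivity) (sub_pos.2 ((le_abs_self _).trans_lt hmid))

lemma strictMonoOn_trig {a b φ : ℝ} (hφ : 0 < φ) (ha : 0 ≤ a)
    (hb : |b| < a * Real.sin φ) :
    StrictMonoOn (fun x : ℝ => a * Real.cos x + b * Real.sin x)
      (Set.Icc (-(π - φ)) (-φ)) := by
  rintro x ⟨hx1, hx2⟩ y ⟨hy1, hy2⟩ hxy
  have hanti := strictAntiOn_trig (b := -b) hφ ha (by rwa [abs_neg])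
  have hy : -y ∈ Set.Icc φ (π - φ) := ⟨by linarith, by linarith⟩
  have hx : -x ∈ Set.Icc φ (π - φ) := ⟨by linarith, by linarith⟩
  simpa using hanti hy hx (neg_lt_neg hxy)

lemma norm_pos_of_mem_K {l : ℕ} (hl : 1 ≤ l) {R r : ℝ} (hr : 0 < r)
    {q : EuclideanSpace ℝ (Fin l × Fin 2)} (hq : q ∈ K l R r) : 0 < ‖q‖ := by
  refine norm_pos_iff.2 fun h => ?_
  have h1 := hq.2 (⟨0, hl⟩, 0)
  rw [h] at h1
  simp at h1
  linarith

/-- Lemma 2: for `T > 0`, `φ ∈ (0, π/3]` and `R ≥ r > 0`, there exists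
`ε > 0` such that for all `q, k ∈ K(R,r)` with cosine similarity at least `1 − ε`, the
Cayley-STRING logit score `s(η) = Σ_m ⟪q_m, rot(η / T) k_m⟫` is strictly decreasing on
`[2Tφ, T(π − φ)]` and strictly increasing on `[−T(π − φ), −2Tφ]`; i.e. `s` is a strictly
decreasing function of `|η|` for `|η| ∈ [2Tφ, T(π − φ)]`. -/
theorem stmt3 {l : ℕ} (hl : 1 ≤ l) (T φ R r : ℝ)
    (hT : 0 < T) (hφ : φ ∈ Set.Ioc 0 (Real.pi / 3)) (hr : 0 < r) (hRr : r ≤ R) :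
    ∃ ε > 0, ∀ q k : EuclideanSpace ℝ (Fin l × Fin 2),
      q ∈ K l R r → k ∈ K l R r → (1 - ε) * ‖q‖ * ‖k‖ ≤ ⟪q, k⟫ →
      StrictAntiOn (fun η : ℝ => ∑ m : Fin l, ⟪blk q m, rot (η / T) (blk k m)⟫)
          (Set.Icc (2 * T * φ) (T * (Real.pi - φ))) ∧
      StrictMonoOn (fun η : ℝ => ∑ m : Fin l, ⟪blk q m, rot (η / T) (blk k m)⟫)
          (Set.Icc (-(T * (Real.pi - φ))) (-(2 * T * φ))) := by
  obtain ⟨hφ0, hφ1⟩ := hφ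
  have hs : 0 < Real.sin φ := Real.sin_pos_of_pos_of_lt_pi hφ0 (by linarith [Real.pi_pos])
  refine ⟨Real.sin φ ^ 2 / 4, by positivity, fun q k hq hk hqk => ?_⟩
  have hN : 0 < ‖q‖ * ‖k‖ :=
    mul_pos (norm_pos_of_mem_K hl hr hq) (norm_pos_of_mem_K hl hr hk)
  have hb := abs_lt_mul_of_near_norm hs (Real.sin_le_one φ) hN
    (sq_inner_add_sq_inner_le (inner_blockPerp_self k) (norm_blockPerp k))
    (by rwa [← mul_assoc])
  have ha : 0 ≤ ⟪q, k⟫ := (pos_of_mul_pos_left ((abs_nonneg _).trans_lt hb) hs.le).le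
  simp only [sum_inner_rot]
  have hdiv : StrictMono fun η : ℝ => η / T := fun x y h => div_lt_div_of_pos_right h hT
  constructor
  · refine (strictAntiOn_trig hφ0 ha hb).comp_strictMonoOn (hdiv.strictMonoOn _) ?_
    rintro η ⟨h1, h2⟩
    refine ⟨(le_div_iff₀ hT).2 ?_, (div_le_iff₀ hT).2 ?_⟩ <;> nlinarith
  · refine (strictMonoOn_trig hφ0 ha hb).comp (hdiv.strictMonoOn _) ?_
    rintro η ⟨h1, h2⟩
    refine ⟨(le_div_iff₀ hT).2 ?_, (div_le_iff₀ hT).2 ?_⟩ <;> nlinarith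

end
end

section
/- Let l ≥ 1, R ≥ r > 0, and φ > 0. Then there exists ε > 0 such that for all q, k ∈ K(R,r) with ⟪q, k⟫ ≥ (1 − ε) · ‖q‖ · ‖k‖, every blockwise angle is at most φ: for every m : Fin l, ∠(q_m, k_m) ≤ φ. (Note that q_m ≠ 0 and k_m ≠ 0 since all their coordinates have absolute value at least r > 0.) -/
open Real Matrix

open scoped RealInnerProductSpace

noncomputable section

lemma inner_eq_sum_inner_blk {l : ℕ} (q k : EuclideanSpace ℝ (Fin l × Fin 2)) :
    ⟪q, k⟫ = ∑ m, ⟪blk q m, blk k m⟫ := by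
  simp [PiLp.inner_apply, Fintype.sum_prod_type, blk]

lemma norm_eq_sqrt_sum_norm_blk_sq {l : ℕ} (q : EuclideanSpace ℝ (Fin l × Fin 2)) :
    ‖q‖ = √(∑ m, ‖blk q m‖ ^ 2) := by
  simp [EuclideanSpace.norm_eq, Fintype.sum_prod_type, blk, Real.sq_sqrt, add_nonneg, sq_nonneg]

/-- The Cauchy–Schwarz defect of a block is at most that of the whole vectors. -/
lemma norm_blk_mul_sub_inner_le {l : ℕ} (q k : EuclideanSpace ℝ (Fin l × Fin 2)) (m : Fin l) :
    ‖blk q m‖ * ‖blk k m‖ - ⟪blk q m, blk k m⟫ ≤ ‖q‖ * ‖k‖ - ⟪q, k⟫ := by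
  have hsum : ∑ n, ‖blk q n‖ * ‖blk k n‖ ≤ ‖q‖ * ‖k‖ := by
    rw [norm_eq_sqrt_sum_norm_blk_sq q, norm_eq_sqrt_sum_norm_blk_sq k]
    exact Real.sum_mul_le_sqrt_mul_sqrt _ _ _
  have hle := Finset.single_le_sum
    (f := fun n => ‖blk q n‖ * ‖blk k n‖ - ⟪blk q n, blk k n⟫)
    (fun n _ => sub_nonneg.2 (real_inner_le_norm _ _)) (Finset.mem_univ m)
  rw [Finset.sum_sub_distrib, ← inner_eq_sum_inner_blk] at hle
  linarith

lemma le_norm_blk {l : ℕ} {R r : ℝ} {q : EuclideanSpace ℝ (Fin l × Fin 2)} (hq : q ∈ K l R r)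
    (m : Fin l) : r ≤ ‖blk q m‖ :=
  (hq.2 (m, 0)).trans (PiLp.norm_apply_le (blk q m) 0)

/-- for `R ≥ r > 0` and `φ > 0` there exists `ε > 0` such that for all
`q, k ∈ K(R,r)` with `⟪q, k⟫ ≥ (1 − ε)‖q‖‖k‖`, every blockwise (unsigned) angle satisfies
`∠(q_m, k_m) ≤ φ`. -/
theorem stmt4 {l : ℕ} (hl : 1 ≤ l) (R r φ : ℝ) (hr : 0 < r) (hRr : r ≤ R) (hφ : 0 < φ) :
    ∃ ε > 0, ∀ q k : EuclideanSpace ℝ (Fin l × Fin 2),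
      q ∈ K l R r → k ∈ K l R r → (1 - ε) * ‖q‖ * ‖k‖ ≤ ⟪q, k⟫ →
      ∀ m : Fin l, InnerProductGeometry.angle (blk q m) (blk k m) ≤ φ := by
  rcases le_or_gt π φ with hπ | hπ
  · exact ⟨1, one_pos, fun q k _ _ _ m => (InnerProductGeometry.angle_le_pi _ _).trans hπ⟩
  have hR : 0 < R := hr.trans_le hRr
  have hcos : 0 < 1 - Real.cos φ := by
    have := Real.cos_lt_cos_of_nonneg_of_le_pi le_rfl hπ.le hφ
    rw [Real.cos_zero] at this
    linarith
  refine ⟨r ^ 2 * (1 - Real.cos φ) / R ^ 2, by positivity, fun q k hq hk h m => ?_⟩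
  by_contra! hlt
  have hcos_lt := Real.cos_lt_cos_of_nonneg_of_le_pi hφ.le
    (InnerProductGeometry.angle_le_pi (blk q m) (blk k m)) hlt
  have hdefect := norm_blk_mul_sub_inner_le q k m
  rw [← InnerProductGeometry.cos_angle_mul_norm_mul_norm (blk q m) (blk k m)] at hdefect
  have hupper : r ^ 2 * (1 - Real.cos φ) / R ^ 2 * (‖q‖ * ‖k‖) ≤ r ^ 2 * (1 - Real.cos φ) := by
    have hqk : ‖q‖ * ‖k‖ ≤ R ^ 2 := by
      rw [sq]
      exact mul_le_mul hq.1 hk.1 (norm_nonneg _) hR.le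
    rw [div_mul_eq_mul_div]
    exact div_le_of_le_mul₀ (by positivity) (by positivity) (by gcongr)
  have hlower : r ^ 2 ≤ ‖blk q m‖ * ‖blk k m‖ := by
    rw [sq]
    exact mul_le_mul (le_norm_blk hq m) (le_norm_blk hk m) hr.le (norm_nonneg _)
  have hr2 : 0 < r ^ 2 := by positivity
  nlinarith

end
end

section
/- Let E be a real inner product space and ρ > 0. Then for all x, y, x', y' ∈ E with ‖x‖ ≥ ρ, ‖y‖ ≥ ρ, ‖x'‖ ≥ ρ, ‖y'‖ ≥ ρ, one has |∠(x, y) − ∠(x', y')| ≤ (π / ρ) · (‖x − x'‖ + ‖y − y'‖); in particular, the angle function (x, y) ↦ ∠(x, y) is Lipschitz on the region where both arguments have norm at least ρ. -/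
open Real

open scoped RealInnerProductSpace

theorem angle_le_pi_div_mul_norm_sub {E : Type*} [NormedAddCommGroup E] [InnerProductSpace ℝ E]
    {ρ : ℝ} (hρ : 0 < ρ) {x y : E} (hx : ρ ≤ ‖x‖) (hy : ρ ≤ ‖y‖) :
    InnerProductGeometry.angle x y ≤ Real.pi / (2 * ρ) * ‖x - y‖ := by
  have h0 := InnerProductGeometry.angle_nonneg x y
  have hcos : Real.cos (InnerProductGeometry.angle x y) ≤
      1 - 2 / Real.pi ^ 2 * InnerProductGeometry.angle x y ^ 2 :=
    Real.cos_le_one_sub_mul_cos_sq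
      (by rw [abs_of_nonneg h0]; exact InnerProductGeometry.angle_le_pi x y)
  have hinner := InnerProductGeometry.cos_angle_mul_norm_mul_norm x y
  have hnorm := norm_sub_sq_real x y
  set θ := InnerProductGeometry.angle x y
  have hprod : ρ * ρ ≤ ‖x‖ * ‖y‖ := mul_le_mul hx hy hρ.le (norm_nonneg x)
  have hq : 0 ≤ 2 / Real.pi ^ 2 * θ ^ 2 := by positivity
  have hsq : (2 * ρ / Real.pi * θ) ^ 2 ≤ ‖x - y‖ ^ 2 := by
    have heq : (2 * ρ / Real.pi * θ) ^ 2 = 2 * ((ρ * ρ) * (2 / Real.pi ^ 2 * θ ^ 2)) := by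
      ring
    have h1 := mul_le_mul_of_nonneg_right hprod hq
    have h2 := mul_le_mul_of_nonneg_right hcos (by positivity : 0 ≤ ‖x‖ * ‖y‖)
    rw [heq, hnorm]
    nlinarith [sq_nonneg (‖x‖ - ‖y‖)]
  have hle : 2 * ρ / Real.pi * θ ≤ ‖x - y‖ := le_of_sq_le_sq hsq (norm_nonneg _)
  calc θ = Real.pi / (2 * ρ) * (2 * ρ / Real.pi * θ) := by field_simp
    _ ≤ Real.pi / (2 * ρ) * ‖x - y‖ := by gcongr

/-- the unsigned angle `∠(x, y) = arccos(⟪x, y⟫ / (‖x‖‖y‖))` is Lipschitz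
(with constant `π / ρ`) on the region where both arguments have norm at least `ρ > 0`. -/
theorem stmt6 {E : Type*} [NormedAddCommGroup E] [InnerProductSpace ℝ E]
    (ρ : ℝ) (hρ : 0 < ρ) (x y x' y' : E)
    (hx : ρ ≤ ‖x‖) (hy : ρ ≤ ‖y‖) (hx' : ρ ≤ ‖x'‖) (hy' : ρ ≤ ‖y'‖) :
    |InnerProductGeometry.angle x y - InnerProductGeometry.angle x' y'| ≤
      (Real.pi / ρ) * (‖x - x'‖ + ‖y - y'‖) := by
  have hxx := angle_le_pi_div_mul_norm_sub hρ hx hx'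
  have hyy := angle_le_pi_div_mul_norm_sub hρ hy hy'
  have t1 := InnerProductGeometry.angle_le_angle_add_angle x x' y
  have t2 := InnerProductGeometry.angle_le_angle_add_angle x' y' y
  have t3 := InnerProductGeometry.angle_le_angle_add_angle x' x y'
  have t4 := InnerProductGeometry.angle_le_angle_add_angle x y y'
  rw [InnerProductGeometry.angle_comm y' y] at t2
  rw [InnerProductGeometry.angle_comm x' x] at t3
  have hhalf : Real.pi / (2 * ρ) * (‖x - x'‖ + ‖y - y'‖) ≤
      Real.pi / ρ * (‖x - x'‖ + ‖y - y'‖) := by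
    gcongr
    linarith
  rw [mul_add] at hhalf
  rw [abs_sub_le_iff]
  constructor <;> linarith
end

section
/- Let l ≥ 1 and let δ_m : ℝ³ →ₗ[ℝ] ℝ (m : Fin l) be linear maps. Then for all r₁, r₂ ∈ ℝ³, the block-diagonal rotation matrices satisfy (RoPE r₁)ᵀ · (RoPE r₂) = RoPE (r₂ − r₁). -/
open Real Matrix

open scoped RealInnerProductSpace

noncomputable section

theorem rotMat_transpose_mul (α β : ℝ) : (rotMat α)ᵀ * rotMat β = rotMat (β - α) := by
  ext i j
  fin_cases i <;> fin_cases j <;>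
    simp [rotMat, Matrix.mul_apply, Fin.sum_univ_two, Real.cos_sub, Real.sin_sub] <;> ring

/-- the block-diagonal RoPE matrices satisfy
`(RoPE r₁)ᵀ · (RoPE r₂) = RoPE (r₂ − r₁)`. -/
theorem stmt9 {l : ℕ} (hl : 1 ≤ l)
    (δ : Fin l → (EuclideanSpace ℝ (Fin 3) →ₗ[ℝ] ℝ))
    (r₁ r₂ : EuclideanSpace ℝ (Fin 3)) :
    (RoPE δ r₁)ᵀ * RoPE δ r₂ = RoPE δ (r₂ - r₁) := by
  ext ⟨m, i⟩ ⟨n, j⟩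
  simp only [Matrix.mul_apply, Matrix.transpose_apply, RoPE, Fintype.sum_prod_type]
  rw [Finset.sum_eq_single m (fun k _ hk => by simp [hk]) (by simp)]
  by_cases h : m = n
  · subst h
    simp [← rotMat_transpose_mul, Matrix.mul_apply]
  · simp [h]

end
end
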